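/- Let f : {−1,1}^n → ℝ with E_x[f(x)²] ≤ 1, let ℓ ≥ 1, κ ≥ 5, Δ ≥ 1 be integers, let ρ = 1 − 1/(2ℓ), let λ(m) = (1 − (1 − ρ^m)^κ)^Δ, and let V ⊆ [n]. Define h : {−1,1}^n → ℝ by h(x) = Σ_{S⊆[n]} (1 − λ(|S ∩ V|)) f̂(S) χ_S(x). Then for every integer γ with 1 ≤ γ ≤ ℓ + 1: Σ_{S ⊆ [n], |S| ≥ γ} ĥ(S)² ≥ E_x[h(x)²] − Δ²·2^{−2κ}. -/

import Mathlib

/-- The sign `±1 ∈ ℝ` associated to a Boolean coordinate value. -/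
noncomputable def sgnB (b : Bool) : ℝ := if b then 1 else -1

/-- The Fourier character `χ_S(x) = ∏_{i ∈ S} x_i` on the Boolean cube `{−1,1}^n`. -/
noncomputable def chi {n : ℕ} (S : Finset (Fin n)) (x : Fin n → Bool) : ℝ :=
  ∏ i ∈ S, sgnB (x i)

/-- Expectation over a uniformly random point of the Boolean cube `{−1,1}^n`. -/
noncomputable def expectCube {n : ℕ} (f : (Fin n → Bool) → ℝ) : ℝ :=
  (∑ x : Fin n → Bool, f x) / 2 ^ n

/-- The Fourier coefficient `f̂(S) = E_x[f(x)·χ_S(x)]`. -/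
noncomputable def fhat {n : ℕ} (f : (Fin n → Bool) → ℝ) (S : Finset (Fin n)) : ℝ :=
  expectCube (fun x => f x * chi S x)

lemma chi_orth {n : ℕ} (S T : Finset (Fin n)) :
    expectCube (fun x => chi S x * chi T x) = if S = T then 1 else 0 := by
  unfold expectCube
  have h1 : ∀ x : Fin n → Bool, chi S x * chi T x =
      ∏ i, ((if i ∈ S then sgnB (x i) else 1) * (if i ∈ T then sgnB (x i) else 1)) := by
    intro x
    rw [Finset.prod_mul_distrib]
    simp [chi, Finset.prod_ite_mem]
  have h2 : ∑ x : Fin n → Bool, chi S x * chi T x =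
      ∏ i, ∑ b : Bool, ((if i ∈ S then sgnB b else 1) * (if i ∈ T then sgnB b else 1)) := by
    rw [Finset.prod_univ_sum]
    simp only [Fintype.piFinset_univ]
    exact Finset.sum_congr rfl (fun x _ => h1 x)
  rw [h2]
  split_ifs with hST
  · subst hST
    have : ∀ i, ∑ b : Bool, ((if i ∈ S then sgnB b else 1) * (if i ∈ S then sgnB b else 1)) = 2 := by
      intro i
      by_cases hi : i ∈ S <;> simp [hi, sgnB] <;> norm_num
    rw [Finset.prod_congr rfl (fun i _ => this i)]
    simp
  · have : ∃ i, ¬ (i ∈ S ↔ i ∈ T) := by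
      by_contra hc
      push Not at hc
      exact hST (Finset.ext hc)
    obtain ⟨i, hi⟩ := this
    rw [Finset.prod_eq_zero (Finset.mem_univ i), zero_div]
    by_cases h1 : i ∈ S <;> by_cases h2 : i ∈ T <;> simp [h1, h2, sgnB] at hi ⊢

lemma expectCube_sum {n : ℕ} {ι : Type*} (s : Finset ι) (F : ι → (Fin n → Bool) → ℝ) :
    expectCube (fun x => ∑ i ∈ s, F i x) = ∑ i ∈ s, expectCube (F i) := by
  unfold expectCube
  rw [Finset.sum_comm, Finset.sum_div]

lemma expectCube_smul {n : ℕ} (c : ℝ) (F : (Fin n → Bool) → ℝ) :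
    expectCube (fun x => c * F x) = c * expectCube F := by
  unfold expectCube
  rw [← Finset.mul_sum, mul_div_assoc]

lemma expectCube_mul_poly {n : ℕ} (a : Finset (Fin n) → ℝ) (g u : (Fin n → Bool) → ℝ)
    (hg : ∀ x, g x = ∑ S, a S * chi S x) :
    expectCube (fun x => u x * g x) = ∑ S, a S * fhat u S := by
  have : (fun x => u x * g x) = fun x => ∑ S, a S * (u x * chi S x) := by
    funext x
    rw [hg, Finset.mul_sum]
    exact Finset.sum_congr rfl (fun S _ => by ring)
  rw [this, expectCube_sum]
  exact Finset.sum_congr rfl (fun S _ => expectCube_smul _ _)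

lemma fhat_poly {n : ℕ} (a : Finset (Fin n) → ℝ) (g : (Fin n → Bool) → ℝ)
    (hg : ∀ x, g x = ∑ S, a S * chi S x) (S : Finset (Fin n)) : fhat g S = a S := by
  have h1 := expectCube_mul_poly a g (chi S) hg
  have h2 : fhat g S = expectCube (fun x => chi S x * g x) := by
    unfold fhat
    congr 1; funext x; ring
  rw [h2, h1]
  unfold fhat
  simp [chi_orth]

lemma parseval_poly {n : ℕ} (a : Finset (Fin n) → ℝ) (g : (Fin n → Bool) → ℝ)
    (hg : ∀ x, g x = ∑ S, a S * chi S x) :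
    expectCube (fun x => g x ^ 2) = ∑ S, a S ^ 2 := by
  have : (fun x => g x ^ 2) = fun x => g x * g x := by funext x; ring
  rw [this, expectCube_mul_poly a g g hg]
  exact Finset.sum_congr rfl (fun S _ => by rw [fhat_poly a g hg]; ring)

lemma bessel {n : ℕ} (f : (Fin n → Bool) → ℝ) :
    ∑ S, fhat f S ^ 2 ≤ expectCube (fun x => f x ^ 2) := by
  set g : (Fin n → Bool) → ℝ := fun x => ∑ S, fhat f S * chi S x with hgd
  have hg : ∀ x, g x = ∑ S, fhat f S * chi S x := fun x => rfl
  have h1 := parseval_poly _ g hg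
  have h2 := expectCube_mul_poly _ g f hg
  have h3 : 0 ≤ expectCube (fun x => (f x - g x) ^ 2) := by
    unfold expectCube
    positivity
  have h4 : expectCube (fun x => (f x - g x) ^ 2) = expectCube (fun x => f x ^ 2)
      - 2 * expectCube (fun x => f x * g x) + expectCube (fun x => g x ^ 2) := by
    unfold expectCube
    rw [← mul_div_assoc, ← sub_div, ← add_div, Finset.mul_sum, ← Finset.sum_sub_distrib,
      ← Finset.sum_add_distrib]
    congr 1
    exact Finset.sum_congr rfl (fun x _ => by ring)
  have h5 : ∑ S, fhat f S * fhat f S = ∑ S, fhat f S ^ 2 :=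
    Finset.sum_congr rfl (fun S _ => by ring)
  rw [h5] at h2
  linarith

lemma coef_bound (ℓ κ Δ m : ℕ) (hℓ : 1 ≤ ℓ) (hm : m ≤ ℓ) (ρ : ℝ)
    (hρ : ρ = 1 - 1 / (2 * (ℓ : ℝ))) :
    (1 - (1 - (1 - ρ ^ m) ^ κ) ^ Δ) ^ 2 ≤ (Δ : ℝ) ^ 2 * (2 : ℝ) ^ (-(2 * (κ : ℤ))) := by
  have hl : (1 : ℝ) ≤ ℓ := by exact_mod_cast hℓ
  have hml : (m : ℝ) ≤ ℓ := by exact_mod_cast hm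
  have hq : 1 / (2 * (ℓ : ℝ)) ≤ 1 / 2 := by
    apply one_div_le_one_div_of_le <;> linarith
  have hq0 : 0 ≤ 1 / (2 * (ℓ : ℝ)) := by positivity
  have hρ0 : 0 ≤ ρ := by linarith
  have hρ1 : ρ ≤ 1 := by linarith
  have hp1 : ρ ^ m ≤ 1 := pow_le_one₀ hρ0 hρ1
  have hb := one_add_mul_le_pow (a := ρ - 1) (by linarith) m
  have hmq : (m : ℝ) * (1 / (2 * (ℓ : ℝ))) ≤ 1 / 2 := by
    rw [mul_one_div, div_le_div_iff₀ (by linarith) (by norm_num)]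
    linarith
  have hp2 : 1 / 2 ≤ ρ ^ m := by
    have e : 1 + (ρ - 1) = ρ := by ring
    rw [e] at hb
    have : (m : ℝ) * (ρ - 1) = - ((m : ℝ) * (1 / (2 * (ℓ : ℝ)))) := by rw [hρ]; ring
    linarith
  set t := (1 - ρ ^ m) ^ κ with ht
  have ht0 : 0 ≤ t := pow_nonneg (by linarith) _
  have ht1 : t ≤ 1 := pow_le_one₀ (by linarith) (by linarith)
  have ht2 : t ≤ (1 / 2) ^ κ := pow_le_pow_left₀ (by linarith) (by linarith) _
  have hc := one_add_mul_le_pow (a := -t) (by linarith) Δ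
  have e : 1 + -t = 1 - t := by ring
  rw [e] at hc
  have hc1 : (1 - t) ^ Δ ≤ 1 := pow_le_one₀ (by linarith) (by linarith)
  have hc2 : 1 - (1 - t) ^ Δ ≤ Δ * (1 / 2) ^ κ := by
    have := mul_le_mul_of_nonneg_left ht2 (Nat.cast_nonneg (α := ℝ) Δ)
    linarith
  have hz : (2 : ℝ) ^ (-(2 * (κ : ℤ))) = ((1 / 2) ^ κ) ^ 2 := by
    rw [zpow_neg, one_div, inv_pow, inv_pow, ← pow_mul, mul_comm κ 2]
    norm_cast
  rw [hz, ← mul_pow]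
  exact pow_le_pow_left₀ (by linarith) hc2 2

/-- Let `f : {−1,1}^n → ℝ` with `E[f²] ≤ 1`, integers `ℓ ≥ 1`, `κ ≥ 5`,
`Δ ≥ 1`, `ρ = 1 − 1/(2ℓ)`, `λ(m) = (1 − (1 − ρ^m)^κ)^Δ`, `V ⊆ [n]`, and define
`h(x) = Σ_S (1 − λ(|S ∩ V|)) f̂(S) χ_S(x)`.  Then for every integer `1 ≤ γ ≤ ℓ + 1`:
`Σ_{|S| ≥ γ} ĥ(S)² ≥ E[h²] − Δ²·2^{−2κ}`. -/
theorem high_level_weight_of_sharpnoise_residual (n ℓ κ Δ : ℕ)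
    (hℓ : 1 ≤ ℓ) (hκ : 5 ≤ κ) (hΔ : 1 ≤ Δ)
    (f : (Fin n → Bool) → ℝ) (hf : expectCube (fun x => f x ^ 2) ≤ 1)
    (ρ : ℝ) (hρ : ρ = 1 - 1 / (2 * (ℓ : ℝ)))
    (lam : ℕ → ℝ) (hlam : ∀ m : ℕ, lam m = (1 - (1 - ρ ^ m) ^ κ) ^ Δ)
    (V : Finset (Fin n)) (h : (Fin n → Bool) → ℝ)
    (hh : ∀ x, h x = ∑ S : Finset (Fin n), (1 - lam ((S ∩ V).card)) * fhat f S * chi S x)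
    (γ : ℕ) (hγ1 : 1 ≤ γ) (hγ2 : γ ≤ ℓ + 1) :
    expectCube (fun x => h x ^ 2) - (Δ : ℝ) ^ 2 * (2 : ℝ) ^ (-(2 * (κ : ℤ))) ≤
      ∑ S ∈ Finset.univ.filter (fun S : Finset (Fin n) => γ ≤ S.card), (fhat h S) ^ 2 := by
  have hfh := fhat_poly _ h hh
  rw [parseval_poly _ h hh,
    ← Finset.sum_filter_add_sum_filter_not Finset.univ
      (fun S : Finset (Fin n) => γ ≤ S.card)]
  simp only [hfh]
  set C := (Δ : ℝ) ^ 2 * (2 : ℝ) ^ (-(2 * (κ : ℤ))) with hC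
  have hC0 : 0 ≤ C := by positivity
  have hlow : ∑ S ∈ Finset.univ.filter (fun S : Finset (Fin n) => ¬ γ ≤ S.card),
      ((1 - lam ((S ∩ V).card)) * fhat f S) ^ 2 ≤ C := by
    calc _ ≤ ∑ S ∈ Finset.univ.filter (fun S : Finset (Fin n) => ¬ γ ≤ S.card),
          C * fhat f S ^ 2 := by
          apply Finset.sum_le_sum
          intro S hS
          have hS' := (Finset.mem_filter.mp hS).2
          have hcard : (S ∩ V).card ≤ S.card := Finset.card_le_card Finset.inter_subset_left
          rw [mul_pow, hlam]
          exact mul_le_mul_of_nonneg_right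
            (coef_bound ℓ κ Δ _ hℓ (by omega) ρ hρ) (sq_nonneg _)
      _ ≤ ∑ S, C * fhat f S ^ 2 :=
          Finset.sum_le_sum_of_subset_of_nonneg (Finset.filter_subset _ _)
            (fun S _ _ => by positivity)
      _ = C * ∑ S, fhat f S ^ 2 := by rw [Finset.mul_sum]
      _ ≤ C * 1 := mul_le_mul_of_nonneg_left ((bessel f).trans hf) hC0
      _ = C := mul_one C
  linarith
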